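/- Let d ≥ 1, 1 ≤ p ≤ ∞, and let f, g : 𝕋^d → ℝ be smooth. Then for every positive integer λ: | ‖f · g(λ·)‖_{L^p(𝕋^d)} − ‖f‖_{L^p(𝕋^d)} ‖g‖_{L^p(𝕋^d)} | ≤ C λ^{−1/p} ‖f‖_{C¹(𝕋^d)} ‖g‖_{L^p(𝕋^d)}, where C depends only on d and p. -/

import Mathlib

open MeasureTheory Real Set ENNReal

noncomputable section

/-- A fundamental domain for the torus `𝕋^d`. -/
def cubeD (d : ℕ) : Set (Fin d → ℝ) := Set.Icc 0 1

/-- Lebesgue measure on the torus `𝕋^d`. -/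
def μD (d : ℕ) : Measure (Fin d → ℝ) := volume.restrict (cubeD d)

/-- `ℤ^d`-periodicity: a function on `ℝ^d` descends to the torus `𝕋^d`. -/
def PeriodicD {d : ℕ} (f : (Fin d → ℝ) → ℝ) : Prop :=
  ∀ (x : Fin d → ℝ) (n : Fin d → ℤ), f (x + fun i => (n i : ℝ)) = f x

/-- The `L^p(𝕋^d)` norm (as a real number). -/
def LpD (d : ℕ) (p : ℝ≥0∞) (f : (Fin d → ℝ) → ℝ) : ℝ := (eLpNorm f p (μD d)).toReal

/-- The `C¹(𝕋^d)` norm: `‖f‖_{L^∞} + ‖∇f‖_{L^∞}`. -/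
def C1D (d : ℕ) (f : (Fin d → ℝ) → ℝ) : ℝ :=
  (eLpNorm f ⊤ (μD d)).toReal +
    (eLpNorm (fun x => (fun i => fderiv ℝ f x (Pi.single i 1) : Fin d → ℝ)) ⊤ (μD d)).toReal

theorem eLpNorm_const_mul_enorm {α : Type*} [MeasurableSpace α] {μ : Measure α} {p : ℝ≥0∞}
    (hp0 : p ≠ 0) (hpt : p ≠ ⊤) (c : ℝ≥0∞) {w : α → ℝ} (hw : Measurable w) :
    eLpNorm (fun x => c * ‖w x‖ₑ) p μ = c * eLpNorm w p μ := by
  have hr : 0 < p.toReal := ENNReal.toReal_pos hp0 hpt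
  rw [eLpNorm_eq_lintegral_rpow_enorm_toReal hp0 hpt,
    eLpNorm_eq_lintegral_rpow_enorm_toReal hp0 hpt]
  simp only [enorm_eq_self, ENNReal.mul_rpow_of_nonneg _ _ hr.le]
  rw [lintegral_const_mul _ (by fun_prop), ENNReal.mul_rpow_of_nonneg _ _ (by positivity),
    ← ENNReal.rpow_mul, mul_one_div_cancel hr.ne', ENNReal.rpow_one]

section Averaging

variable {G K : Type*} [AddGroup G] [MeasurableSpace G] [MeasurableAdd G]
  [MeasurableSpace K] [Countable K] [MeasurableSingletonClass K]
  {μ : Measure G} {ν : Measure K} {j : K → G} {p : ℝ≥0∞}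

theorem measurable_shift {E : Type*} [MeasurableSpace E] {f : G → E} (hf : Measurable f) :
    Measurable fun z : G × K => f (z.1 + j z.2) :=
  measurable_from_prod_countable_left fun k => hf.comp (measurable_add_const (j k))

theorem measurable_eLpNorm_shift [SFinite ν] (hp0 : p ≠ 0) (hpt : p ≠ ⊤) {f : G → ℝ}
    (hf : Measurable f) :
    Measurable fun x => eLpNorm (fun k => f (x + j k)) p ν := by
  simp only [eLpNorm_eq_lintegral_rpow_enorm_toReal hp0 hpt]
  have := ((measurable_shift (j := j) hf).enorm.pow_const p.toReal).lintegral_prod_right' (ν := ν)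
  exact this.pow_const _

/-- A product with a `j`-invariant weight may be averaged over the shifts `j k`. -/
theorem eLpNorm_mul_eq_eLpNorm_average [SFinite μ] [μ.IsAddRightInvariant]
    [IsProbabilityMeasure ν] (hp0 : p ≠ 0) (hpt : p ≠ ⊤) {f w : G → ℝ} (hf : Measurable f)
    (hw : Measurable w) (hwj : ∀ x k, w (x + j k) = w x) :
    eLpNorm (fun x => f x * w x) p μ
      = eLpNorm (fun x => eLpNorm (fun k => f (x + j k)) p ν * ‖w x‖ₑ) p μ := by
  have hr : 0 < p.toReal := ENNReal.toReal_pos hp0 hpt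
  simp only [eLpNorm_eq_lintegral_rpow_enorm_toReal hp0 hpt, enorm_eq_self, enorm_mul]
  congr 1
  set H : G → ℝ≥0∞ := fun x => (‖f x‖ₑ * ‖w x‖ₑ) ^ p.toReal with hH
  have hHm : Measurable H := by fun_prop
  calc ∫⁻ x, H x ∂μ = ∫⁻ _k, (∫⁻ x, H x ∂μ) ∂ν := by simp
    _ = ∫⁻ k, (∫⁻ x, H (x + j k) ∂μ) ∂ν := by simp only [lintegral_add_right_eq_self]
    _ = ∫⁻ x, (∫⁻ k, H (x + j k) ∂ν) ∂μ := by
      refine lintegral_lintegral_swap (f := fun k x => H (x + j k)) ?_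
      exact ((measurable_shift (j := j) hHm).comp measurable_swap).aemeasurable
    _ = _ := by
      refine lintegral_congr fun x => ?_
      have hm : Measurable fun k => ‖f (x + j k)‖ₑ ^ p.toReal := measurable_of_countable _
      simp only [hH, hwj, ENNReal.mul_rpow_of_nonneg _ _ hr.le]
      rw [lintegral_mul_const _ hm, ← ENNReal.rpow_mul, one_div_mul_cancel hr.ne',
        ENNReal.rpow_one]

/-- If the local averages of `f` over the shifts `j k` oscillate by at most `ε`, then `f`
decorrelates from any `j`-invariant weight up to `ε`. -/
theorem eLpNorm_mul_near [IsProbabilityMeasure μ] [μ.IsAddRightInvariant]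
    [IsProbabilityMeasure ν] (hp1 : 1 ≤ p) (hpt : p ≠ ⊤) {f w : G → ℝ} (hf : Measurable f)
    (hw : Measurable w) (hwj : ∀ x k, w (x + j k) = w x) {ε : ℝ≥0∞}
    (hosc : ∀ x y, eLpNorm (fun k => f (x + j k)) p ν ≤ eLpNorm (fun k => f (y + j k)) p ν + ε) :
    eLpNorm (fun x => f x * w x) p μ ≤ (eLpNorm f p μ + ε) * eLpNorm w p μ ∧
      eLpNorm f p μ * eLpNorm w p μ
        ≤ eLpNorm (fun x => f x * w x) p μ + ε * eLpNorm w p μ := by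
  have hp0 : p ≠ 0 := (zero_lt_one.trans_le hp1).ne'
  have hμ : μ ≠ 0 := IsProbabilityMeasure.ne_zero μ
  set F : G → ℝ≥0∞ := fun x => eLpNorm (fun k => f (x + j k)) p ν with hF
  have hFm : Measurable F := measurable_eLpNorm_shift hp0 hpt hf
  have hN : eLpNorm f p μ = eLpNorm F p μ := by
    simpa using eLpNorm_mul_eq_eLpNorm_average (μ := μ) (ν := ν) (j := j) hp0 hpt hf
      (measurable_const (a := (1 : ℝ))) (fun _ _ => rfl)
  have hconst (c : ℝ≥0∞) : eLpNorm (fun _ : G => c) p μ = c := by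
    rw [eLpNorm_const _ hp0 hμ]; simp
  have hup (x : G) : F x ≤ eLpNorm f p μ + ε := by
    rw [← tsub_le_iff_right, hN, ← hconst (F x - ε)]
    exact eLpNorm_mono_enorm fun y => by simpa using hosc x y
  have hlo (x : G) : eLpNorm f p μ ≤ F x + ε := by
    rw [hN, ← hconst (F x + ε)]
    exact eLpNorm_mono_enorm fun y => by simpa using hosc y x
  rw [eLpNorm_mul_eq_eLpNorm_average (ν := ν) hp0 hpt hf hw hwj]
  refine ⟨?_, ?_⟩
  · rw [← eLpNorm_const_mul_enorm hp0 hpt _ hw]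
    refine eLpNorm_mono_enorm fun x => ?_
    simp only [enorm_eq_self]
    gcongr
    exact hup x
  · rw [← eLpNorm_const_mul_enorm hp0 hpt _ hw, ← eLpNorm_const_mul_enorm hp0 hpt _ hw]
    refine le_trans ?_ (eLpNorm_add_le (hFm.mul hw.enorm).aestronglyMeasurable
      (hw.enorm.const_mul ε).aestronglyMeasurable hp1)
    refine eLpNorm_mono_enorm fun x => ?_
    simp only [enorm_eq_self, Pi.add_apply, ← add_mul]
    gcongr
    exact hlo x

end Averaging

section Torus

variable {d : ℕ}

/-- The covering map `ℝ^d → 𝕋^d`. -/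
def toTorus (x : Fin d → ℝ) : UnitAddTorus (Fin d) := fun i => (x i : UnitAddCircle)

theorem toTorus_add (x y : Fin d → ℝ) : toTorus (x + y) = toTorus x + toTorus y := rfl

theorem toTorus_sub (x y : Fin d → ℝ) : toTorus (x - y) = toTorus x - toTorus y := rfl

theorem toTorus_natCast_smul (n : ℕ) (x : Fin d → ℝ) :
    toTorus ((n : ℝ) • x) = (n : ℤ) • toTorus x := by
  ext i
  change (((n : ℝ) * x i : ℝ) : UnitAddCircle) = (n : ℤ) • (x i : UnitAddCircle)
  rw [← nsmul_eq_mul, AddCircle.coe_nsmul, natCast_zsmul]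

theorem isOpenQuotientMap_toTorus : IsOpenQuotientMap (toTorus (d := d)) :=
  IsOpenQuotientMap.piMap fun _ => QuotientAddGroup.isOpenQuotientMap_mk

theorem measurePreserving_toTorus : MeasurePreserving (toTorus (d := d)) (μD d) volume := by
  have h := measurePreserving_pi _ _ fun _ : Fin d => UnitAddCircle.measurePreserving_mk 0
  rw [← Measure.restrict_pi_pi] at h
  have : μD d = (Measure.pi fun _ : Fin d => (volume : Measure ℝ)).restrict
      (univ.pi fun _ => Ioc 0 (0 + 1)) := by
    rw [zero_add]
    exact (Measure.restrict_congr_set Measure.univ_pi_Ioc_ae_eq_Icc).symm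
  rw [this]
  exact h

theorem isProbabilityMeasure_volume_torus :
    IsProbabilityMeasure (volume : Measure (UnitAddTorus (Fin d))) :=
  ⟨by rw [volume_pi, Measure.pi_univ]; simp⟩

theorem measurePreserving_zsmul_torus {n : ℤ} (hn : n ≠ 0) :
    MeasurePreserving (fun t : UnitAddTorus (Fin d) => n • t) volume volume :=
  Measure.measurePreserving_zsmul volume hn

theorem exists_torus_lift {E : Type*} [TopologicalSpace E] {f : (Fin d → ℝ) → E}
    (hf : Continuous f)
    (hper : ∀ (x : Fin d → ℝ) (n : Fin d → ℤ), f (x + fun i => (n i : ℝ)) = f x) :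
    ∃ F : UnitAddTorus (Fin d) → E, Continuous F ∧ ∀ x, F (toTorus x) = f x := by
  have hfac : ∀ x y : Fin d → ℝ, toTorus x = toTorus y → f x = f y := by
    intro x y hxy
    have (i : Fin d) : ∃ n : ℤ, y i + n = x i := by
      obtain ⟨n, hn⟩ := AddSubgroup.mem_zmultiples_iff.1
        (QuotientAddGroup.eq.1 (congrFun hxy.symm i))
      refine ⟨n, ?_⟩
      simp at hn
      linarith
    choose n hn using this
    rw [← hper y n]
    congr 1
    ext i
    simp [hn]
  have hq := isOpenQuotientMap_toTorus (d := d)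
  choose s hs using hq.surjective
  have hF (x : Fin d → ℝ) : f (s (toTorus x)) = f x := hfac _ _ (hs _)
  refine ⟨f ∘ s, ?_, hF⟩
  rw [hq.isQuotientMap.continuous_iff]
  exact hf.congr fun x => (hF x).symm

theorem eLpNorm_comp_toTorus {E : Type*} [NormedAddCommGroup E] {p : ℝ≥0∞}
    {F : UnitAddTorus (Fin d) → E} (hF : Continuous F) {f : (Fin d → ℝ) → E}
    (h : ∀ x, F (toTorus x) = f x) :
    eLpNorm f p (μD d) = eLpNorm F p volume := by
  rw [← eLpNorm_comp_measurePreserving (hF.stronglyMeasurable_of_hasCompactSupport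
    (HasCompactSupport.of_compactSpace F)).aestronglyMeasurable measurePreserving_toTorus]
  congr 1
  ext x
  exact (h x).symm

theorem eLpNorm_torus_ne_top {E : Type*} [NormedAddCommGroup E] {p : ℝ≥0∞}
    {F : UnitAddTorus (Fin d) → E} (hF : Continuous F) : eLpNorm F p volume ≠ ⊤ := by
  have := isProbabilityMeasure_volume_torus (d := d)
  obtain ⟨C, hC⟩ := isCompact_univ.exists_bound_of_continuousOn hF.continuousOn
  refine ((eLpNorm_le_of_ae_bound (.of_forall fun x => hC x trivial)).trans_lt ?_).ne
  simp

theorem norm_le_eLpNorm_top {E : Type*} [NormedAddCommGroup E]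
    {F : UnitAddTorus (Fin d) → E} (hF : Continuous F) (t : UnitAddTorus (Fin d)) :
    ‖F t‖ ≤ (eLpNorm F ⊤ volume).toReal := by
  rw [← toReal_enorm]
  refine ENNReal.toReal_mono (eLpNorm_torus_ne_top hF) ?_
  by_contra! hlt
  have hopen : IsOpen {s | eLpNorm F ⊤ volume < ‖F s‖ₑ} :=
    isOpen_lt continuous_const hF.enorm
  refine (hopen.measure_pos volume ⟨t, hlt⟩).ne' ?_
  have := enorm_ae_le_eLpNormEssSup F volume
  simpa [ae_iff, eLpNorm_exponent_top] using this

theorem norm_sub_le_of_partials {f : (Fin d → ℝ) → ℝ} (hf : Differentiable ℝ f) {L : ℝ}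
    (hL : ∀ x, ‖fun i => fderiv ℝ f x (Pi.single i 1)‖ ≤ L) (x y : Fin d → ℝ) :
    ‖f y - f x‖ ≤ d * L * ‖y - x‖ := by
  have hL0 : 0 ≤ L := (norm_nonneg _).trans (hL 0)
  refine convex_univ.norm_image_sub_le_of_norm_fderiv_le (𝕜 := ℝ) (fun x _ => hf x)
    (fun x _ => ?_) trivial trivial
  refine ContinuousLinearMap.opNorm_le_bound _ (by positivity) fun v => ?_
  calc ‖fderiv ℝ f x v‖ = ‖∑ i, v i * fderiv ℝ f x (Pi.single i 1)‖ := by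
        conv_lhs => rw [pi_eq_sum_univ' v, map_sum]
        simp
    _ ≤ ∑ _i : Fin d, ‖v‖ * L := by
        refine norm_sum_le_of_le _ fun i _ => ?_
        rw [norm_mul]
        exact mul_le_mul (norm_le_pi_norm v i) ((norm_le_pi_norm _ i).trans (hL x))
          (norm_nonneg _) (norm_nonneg _)
    _ = d * L * ‖v‖ := by simp; ring

/-- The embedding of `(ℤ/N)^d` as the `N`-torsion of `𝕋^d`. -/
def torsionShift (N : ℕ) [NeZero N] (k : Fin d → ZMod N) : UnitAddTorus (Fin d) :=
  fun i => ZMod.toAddCircle (k i)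

theorem smul_torsionShift (N : ℕ) [NeZero N] (k : Fin d → ZMod N) :
    (N : ℤ) • torsionShift N k = 0 := by
  ext i
  simp [torsionShift, ← map_nsmul]

theorem torsionShift_sub (N : ℕ) [NeZero N] (k l : Fin d → ZMod N) :
    torsionShift N (k - l) = torsionShift N k - torsionShift N l := by
  ext i
  simp [torsionShift]

theorem torsionShift_intCast (N : ℕ) [NeZero N] (n : Fin d → ℤ) :
    torsionShift N (fun i => (n i : ZMod N)) = toTorus fun i => (n i : ℝ) / N := by
  ext i
  simp [torsionShift, toTorus, ZMod.toAddCircle_intCast]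

theorem eLpNorm_torsionShift_le {N : ℕ} [NeZero N] {p : ℝ≥0∞} (hp : 1 ≤ p)
    [MeasurableSpace (ZMod N)] [MeasurableSingletonClass (ZMod N)]
    {ν : Measure (Fin d → ZMod N)} [IsProbabilityMeasure ν] [ν.IsAddRightInvariant]
    {F : UnitAddTorus (Fin d) → ℝ} {M : ℝ} (hM : 0 ≤ M)
    (hF : ∀ x y : Fin d → ℝ, ‖F (toTorus y) - F (toTorus x)‖ ≤ M * ‖y - x‖)
    (x y : UnitAddTorus (Fin d)) :
    eLpNorm (fun k => F (x + torsionShift N k)) p ν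
      ≤ eLpNorm (fun k => F (y + torsionShift N k)) p ν + ENNReal.ofReal (M / N) := by
  have hN : (0 : ℝ) < N := Nat.cast_pos.2 (NeZero.pos N)
  obtain ⟨a, rfl⟩ := isOpenQuotientMap_toTorus.surjective x
  obtain ⟨b, rfl⟩ := isOpenQuotientMap_toTorus.surjective y
  set n : Fin d → ℤ := fun i => round (N * (b i - a i)) with hn
  set l : Fin d → ZMod N := fun i => (n i : ZMod N) with hl
  set c : Fin d → ℝ := fun i => (n i : ℝ) / N with hc
  have hcl : torsionShift N l = toTorus c := torsionShift_intCast N n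
  have hclose : ‖a - (b - c)‖ ≤ 1 / N := by
    refine (pi_norm_le_iff_of_nonneg (by positivity)).2 fun i => ?_
    have h1 := abs_sub_round (N * (b i - a i))
    have h2 : (a - (b - c)) i = -(N * (b i - a i) - n i) / N := by
      simp only [Pi.sub_apply, hc]; field_simp; ring
    rw [h2, Real.norm_eq_abs, abs_div, abs_neg, abs_of_pos hN]
    gcongr
    linarith
  have hshift : eLpNorm (fun k => F (toTorus b + torsionShift N (k - l))) p ν
      = eLpNorm (fun k => F (toTorus b + torsionShift N k)) p ν :=
    eLpNorm_comp_measurePreserving (g := fun k => F (toTorus b + torsionShift N k))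
      (measurable_of_countable _).aestronglyMeasurable (measurePreserving_sub_right ν l)
  set u := fun k => F (toTorus a + torsionShift N k) with hu
  set v := fun k => F (toTorus b + torsionShift N (k - l)) with hv
  have hdiff : eLpNorm (u - v) p ν ≤ ENNReal.ofReal (M / N) := by
    refine (eLpNorm_le_of_ae_bound (C := M / N) (.of_forall fun k => ?_)).trans (by simp)
    obtain ⟨e, he⟩ := isOpenQuotientMap_toTorus.surjective (torsionShift N k)
    have h1 : toTorus b + torsionShift N (k - l) = toTorus (b - c + e) := by
      rw [torsionShift_sub, hcl, ← he, toTorus_add, toTorus_sub]; abel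
    have h2 : toTorus a + torsionShift N k = toTorus (a + e) := by rw [toTorus_add, he]
    simp only [Pi.sub_apply, hu, hv, h1, h2]
    refine (hF _ _).trans ?_
    rw [add_sub_add_right_eq_sub, div_eq_mul_one_div]
    gcongr
  rw [← hshift]
  calc eLpNorm u p ν = eLpNorm (v + (u - v)) p ν := by rw [add_sub_cancel]
    _ ≤ eLpNorm v p ν + eLpNorm (u - v) p ν :=
      eLpNorm_add_le (measurable_of_countable _).aestronglyMeasurable
        (measurable_of_countable _).aestronglyMeasurable hp
    _ ≤ _ := by gcongr

theorem exists_invariant_probabilityMeasure (K : Type*) [AddGroup K] [Finite K]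
    [MeasurableSpace K] [MeasurableSingletonClass K] [MeasurableAdd K] :
    ∃ ν : Measure K, IsProbabilityMeasure ν ∧ ν.IsAddRightInvariant := by
  have : Fintype K := Fintype.ofFinite K
  refine ⟨(Fintype.card K : ℝ≥0∞)⁻¹ • Measure.count, ⟨?_⟩, inferInstance⟩
  simp [ENNReal.inv_mul_cancel]

end Torus

/-- Decorrelation at rate `1 / N` for functions on the torus, finite exponent. -/
theorem eLpNorm_mul_comp_zsmul_near {d : ℕ} {p : ℝ≥0∞} (hp1 : 1 ≤ p) (hpt : p ≠ ⊤)
    {F H : UnitAddTorus (Fin d) → ℝ} (hFc : Continuous F) (hHc : Continuous H)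
    {M : ℝ} (hM : 0 ≤ M)
    (hF : ∀ x y : Fin d → ℝ, ‖F (toTorus y) - F (toTorus x)‖ ≤ M * ‖y - x‖)
    {N : ℕ} (hN : 0 < N) :
    |(eLpNorm (fun t => F t * H ((N : ℤ) • t)) p volume).toReal
        - (eLpNorm F p volume).toReal * (eLpNorm H p volume).toReal|
      ≤ M / N * (eLpNorm H p volume).toReal := by
  have : NeZero N := ⟨hN.ne'⟩
  have := isProbabilityMeasure_volume_torus (d := d)
  let _ : MeasurableSpace (ZMod N) := ⊤
  obtain ⟨ν, hν, hν'⟩ := exists_invariant_probabilityMeasure (Fin d → ZMod N)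
  have hHN : Continuous fun t : UnitAddTorus (Fin d) => H ((N : ℤ) • t) :=
    hHc.comp (continuous_zsmul _)
  have hscale : eLpNorm (fun t => H ((N : ℤ) • t)) p volume = eLpNorm H p volume :=
    eLpNorm_comp_measurePreserving hHc.measurable.aestronglyMeasurable
      (measurePreserving_zsmul_torus (by exact_mod_cast hN.ne'))
  have key := eLpNorm_mul_near (μ := volume) (ν := ν) (j := torsionShift N) hp1 hpt
    hFc.measurable hHN.measurable
    (fun x k => by rw [smul_add, smul_torsionShift, add_zero])
    (eLpNorm_torsionShift_le hp1 hM hF)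
  rw [hscale] at key
  have hA : eLpNorm (fun t => F t * H ((N : ℤ) • t)) p volume ≠ ⊤ :=
    eLpNorm_torus_ne_top (hFc.mul hHN)
  have hB : eLpNorm F p volume ≠ ⊤ := eLpNorm_torus_ne_top hFc
  have hC : eLpNorm H p volume ≠ ⊤ := eLpNorm_torus_ne_top hHc
  have hε : (ENNReal.ofReal (M / N)).toReal = M / N := ENNReal.toReal_ofReal (by positivity)
  have h1 := ENNReal.toReal_mono (by finiteness) key.1
  have h2 := ENNReal.toReal_mono (by finiteness) key.2
  rw [ENNReal.toReal_mul, ENNReal.toReal_add hB (by finiteness), hε] at h1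
  rw [ENNReal.toReal_mul, ENNReal.toReal_add hA (by finiteness), ENNReal.toReal_mul, hε] at h2
  rw [abs_le]
  constructor <;> linarith

theorem eLpNorm_top_mul_comp_zsmul_near {d : ℕ}
    {F H : UnitAddTorus (Fin d) → ℝ} (hFc : Continuous F) (hHc : Continuous H)
    {N : ℕ} (hN : 0 < N) :
    |(eLpNorm (fun t => F t * H ((N : ℤ) • t)) ⊤ volume).toReal
        - (eLpNorm F ⊤ volume).toReal * (eLpNorm H ⊤ volume).toReal|
      ≤ (eLpNorm F ⊤ volume).toReal * (eLpNorm H ⊤ volume).toReal := by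
  have hscale : eLpNorm (fun t => H ((N : ℤ) • t)) ⊤ volume = eLpNorm H ⊤ volume :=
    eLpNorm_comp_measurePreserving hHc.measurable.aestronglyMeasurable
      (measurePreserving_zsmul_torus (by exact_mod_cast hN.ne'))
  have hHN : Continuous fun t : UnitAddTorus (Fin d) => H ((N : ℤ) • t) :=
    hHc.comp (continuous_zsmul _)
  have h := eLpNorm_le_eLpNorm_top_mul_eLpNorm (μ := volume) ⊤ F
    hHN.measurable.aestronglyMeasurable (fun a b => a * b) 1
    (.of_forall fun x => by simp)
  rw [hscale, ENNReal.coe_one, one_mul] at h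
  have h1 := ENNReal.toReal_mono
    (ENNReal.mul_ne_top (eLpNorm_torus_ne_top hFc) (eLpNorm_torus_ne_top hHc)) h
  rw [ENNReal.toReal_mul] at h1
  have h0 : 0 ≤ (eLpNorm (fun t => F t * H ((N : ℤ) • t)) ⊤ volume).toReal :=
    ENNReal.toReal_nonneg
  rw [abs_le]
  constructor <;> linarith

/-- Decorrelation estimate: for smooth `f, g : 𝕋^d → ℝ` and a positive
integer `λ`, `| ‖f · g(λ·)‖_{L^p} − ‖f‖_{L^p} ‖g‖_{L^p} | ≤ C λ^{−1/p} ‖f‖_{C¹} ‖g‖_{L^p}`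
with `C` depending only on `d` and `p`. -/
theorem decorrelation_Lp
    (d : ℕ) (hd : 1 ≤ d) (p : ℝ≥0∞) (hp : 1 ≤ p) :
    ∃ C : ℝ, 0 < C ∧
      ∀ f g : (Fin d → ℝ) → ℝ,
        ContDiff ℝ (⊤ : ℕ∞) f → PeriodicD f →
        ContDiff ℝ (⊤ : ℕ∞) g → PeriodicD g →
        ∀ lam : ℕ, 0 < lam →
          |LpD d p (fun x => f x * g ((lam : ℝ) • x)) - LpD d p f * LpD d p g|
            ≤ C * (lam : ℝ) ^ (-(p.toReal⁻¹)) * C1D d f * LpD d p g := by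
  have hd' : (1 : ℝ) ≤ d := by exact_mod_cast hd
  refine ⟨d, by linarith, fun f g hf hfp hg hgp lam hlam => ?_⟩
  obtain ⟨F, hFc, hFf⟩ := exists_torus_lift hf.continuous hfp
  obtain ⟨H, hHc, hHg⟩ := exists_torus_lift hg.continuous hgp
  have hfderiv : Continuous (fderiv ℝ f) := hf.continuous_fderiv (by simp)
  obtain ⟨D, hDc, hDf⟩ := exists_torus_lift
    (f := fun x => (fun i => fderiv ℝ f x (Pi.single i 1) : Fin d → ℝ))
    (by fun_prop) (fun x n => by
      have : (fun y => f (y + fun i => (n i : ℝ))) = f := funext fun y => hfp y n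
      rw [← fderiv_comp_add_right, this])
  have hprod : Continuous fun t => F t * H ((lam : ℤ) • t) :=
    hFc.mul (hHc.comp (continuous_zsmul _))
  simp only [LpD, C1D]
  rw [eLpNorm_comp_toTorus hFc hFf, eLpNorm_comp_toTorus hHc hHg, eLpNorm_comp_toTorus hDc hDf,
    eLpNorm_comp_toTorus hFc hFf,
    eLpNorm_comp_toTorus hprod (fun x => by rw [← toTorus_natCast_smul, hFf, hHg])]
  set L := (eLpNorm D ⊤ volume).toReal
  have hL0 : 0 ≤ L := ENNReal.toReal_nonneg
  have hA0 : 0 ≤ (eLpNorm F ⊤ volume).toReal := ENNReal.toReal_nonneg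
  have hB0 : 0 ≤ (eLpNorm H p volume).toReal := ENNReal.toReal_nonneg
  have hlam1 : (1 : ℝ) ≤ lam := by exact_mod_cast hlam
  rcases eq_or_ne p ⊤ with rfl | hpt
  · refine (eLpNorm_top_mul_comp_zsmul_near hFc hHc hlam).trans ?_
    simp only [ENNReal.toReal_top, _root_.inv_zero, neg_zero, Real.rpow_zero, mul_one]
    gcongr
    nlinarith
  · have hlip := norm_sub_le_of_partials (hf.differentiable (by simp)) (L := L)
      (fun x => by rw [← hDf]; exact norm_le_eLpNorm_top hDc _)
    refine (eLpNorm_mul_comp_zsmul_near hp hpt hFc hHc (M := d * L) (by positivity)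
      (fun x y => by rw [hFf, hFf]; exact hlip x y) hlam).trans ?_
    have hrate : (lam : ℝ)⁻¹ ≤ (lam : ℝ) ^ (-(p.toReal⁻¹)) := by
      rw [← Real.rpow_neg_one]
      refine Real.rpow_le_rpow_of_exponent_le hlam1 (neg_le_neg (inv_le_one_of_one_le₀ ?_))
      rw [← ENNReal.toReal_one]
      exact ENNReal.toReal_mono hpt hp
    calc d * L / lam * (eLpNorm H p volume).toReal
        = d * (lam : ℝ)⁻¹ * L * (eLpNorm H p volume).toReal := by ring
      _ ≤ _ := by gcongr; linarith

end
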